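/- Let C ⊂ ℝ³ be a convex body and r₀ ∈ ∂C a ridge point whose tangent cone is the dihedral angle {r : (r − r₀, e₁) ≤ 0, (r − r₀, e₂) ≤ 0}, and let e = λ₁e₁ + λ₂e₂ with λ₁ > 0, λ₂ > 0, |e| = 1. Then the support of every partial weak limit of the normalized surface measures ν_t as t → 0⁺ contains both points e₁ and e₂. -/

import Mathlib

open MeasureTheory Set Filter Topology
open scoped RealInnerProductSpace ENNReal

noncomputable section

attribute [local instance] Classical.propDecidable

abbrev E3 := EuclideanSpace ℝ (Fin 3)

/-- A convex body: a compact convex set with nonempty interior. -/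
def IsConvexBody (C : Set E3) : Prop :=
  IsCompact C ∧ Convex ℝ C ∧ (interior C).Nonempty

/-- The tangent cone to a convex set `C` at the point `r₀`: the closure of the set of
rays from `r₀` through points of `C`, translated to the origin. -/
def tanCone (C : Set E3) (r₀ : E3) : Set E3 :=
  closure {v : E3 | ∃ c : ℝ, ∃ r ∈ C, 0 ≤ c ∧ v = c • (r - r₀)}

/-- The dihedral angle `{v : ⟪v,e₁⟫ ≤ 0, ⟪v,e₂⟫ ≤ 0}` (as a cone of displacements). -/
def dihedral (e₁ e₂ : E3) : Set E3 := {v : E3 | ⟪v, e₁⟫ ≤ 0 ∧ ⟪v, e₂⟫ ≤ 0}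

/-- `n` is an outward unit normal of `C` at `r`. -/
def IsOutwardNormalAt (C : Set E3) (r n : E3) : Prop :=
  ‖n‖ = 1 ∧ ∀ x ∈ C, ⟪x - r, n⟫ ≤ 0

/-- `r` is a regular boundary point: the outward unit normal exists and is unique. -/
def IsRegularPt (C : Set E3) (r : E3) : Prop :=
  ∃! n : E3, IsOutwardNormalAt C r n

/-- The (Gauss) normal map of `C`, sending a boundary point to an outward unit normal
(the unique one at regular points), and junk value `0` elsewhere. -/
def normalMap (C : Set E3) (r : E3) : E3 :=
  if h : ∃ n : E3, IsOutwardNormalAt C r n then h.choose else 0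

/-- `B_t = C ∩ {r : ⟪r - r₀, e⟫ = -t}`. -/
def Bset (C : Set E3) (r₀ e : E3) (t : ℝ) : Set E3 :=
  C ∩ {r : E3 | ⟪r - r₀, e⟫ = -t}

/-- `S_t = ∂C ∩ {r : ⟪r - r₀, e⟫ ≥ -t}`. -/
def Sset (C : Set E3) (r₀ e : E3) (t : ℝ) : Set E3 :=
  frontier C ∩ {r : E3 | ⟪r - r₀, e⟫ ≥ -t}

/-- The normalized surface measure `ν_t` induced by `S_t`: the pushforward under the
normal map of the 2-dimensional Hausdorff measure restricted to the regular points of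
`S_t`, normalized by the area of `B_t`. -/
def nuT (C : Set E3) (r₀ e : E3) (t : ℝ) : Measure E3 :=
  (μH[2] (Bset C r₀ e t))⁻¹ •
    Measure.map (normalMap C) (μH[2].restrict (Sset C r₀ e t ∩ {r : E3 | IsRegularPt C r}))

/-- The arc `Γ = {μ₁e₁ + μ₂e₂ : |μ₁e₁ + μ₂e₂| = 1, μ₁ ≥ 0, μ₂ ≥ 0}`. -/
def arcGamma (e₁ e₂ : E3) : Set E3 :=
  {v : E3 | ∃ m₁ m₂ : ℝ, 0 ≤ m₁ ∧ 0 ≤ m₂ ∧ v = m₁ • e₁ + m₂ • e₂ ∧ ‖v‖ = 1}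

/-- Weak convergence of the family `ν t` to `ν₀` as `t → 0⁺`. -/
def WeaklyTendsto (ν : ℝ → Measure E3) (ν₀ : Measure E3) : Prop :=
  ∀ f : BoundedContinuousFunction E3 ℝ,
    Tendsto (fun t => ∫ x, f x ∂(ν t)) (𝓝[>] (0 : ℝ)) (𝓝 (∫ x, f x ∂ν₀))

/-- `ν₀` is a partial weak limit of the family `ν t` as `t → 0⁺`. -/
def IsPartialWeakLimit (ν : ℝ → Measure E3) (ν₀ : Measure E3) : Prop :=
  ∃ ts : ℕ → ℝ, (∀ i, 0 < ts i) ∧ Tendsto ts atTop (𝓝 (0 : ℝ)) ∧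
    ∀ f : BoundedContinuousFunction E3 ℝ,
      Tendsto (fun i => ∫ x, f x ∂(ν (ts i))) atTop (𝓝 (∫ x, f x ∂ν₀))

/-- The support of a measure: points all of whose open neighborhoods have positive measure. -/
def msupport (ν : Measure E3) : Set E3 :=
  {x : E3 | ∀ U : Set E3, IsOpen U → x ∈ U → 0 < ν U}


lemma hmeas_le_of_antilip {X Y : Type*} [EMetricSpace X] [MeasurableSpace X] [BorelSpace X]
    [EMetricSpace Y] [MeasurableSpace Y] [BorelSpace Y] (f : X → Y) (s : Set X) (K : NNReal)
    (h : ∀ x ∈ s, ∀ y ∈ s, edist x y ≤ K * edist (f x) (f y)) :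
    μH[2] s ≤ (K : ℝ≥0∞) ^ (2 : ℝ) * μH[2] (f '' s) := by
  rcases s.eq_empty_or_nonempty with rfl | ⟨x0, hx0⟩
  · simp
  have : Nonempty X := ⟨x0⟩
  let g := Function.invFunOn f s
  have hinj : InjOn f s := by
    intro x hx y hy hxy
    have := h x hx y hy
    rw [hxy, edist_self, mul_zero] at this
    exact edist_le_zero.1 this
  have hg : ∀ x ∈ s, g (f x) = x := fun x hx => hinj.leftInvOn_invFunOn hx
  have hlip : LipschitzOnWith K g (f '' s) := by
    rintro _ ⟨x, hx, rfl⟩ _ ⟨y, hy, rfl⟩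
    rw [hg x hx, hg y hy]
    exact h x hx y hy
  have := hlip.hausdorffMeasure_image_le (d := 2) (by norm_num)
  refine le_trans (measure_mono ?_) this
  intro x hx
  exact ⟨f x, ⟨x, hx, rfl⟩, hg x hx⟩

lemma hmeas_le_of_antilip_real {X Y : Type*} [MetricSpace X] [MeasurableSpace X] [BorelSpace X]
    [MetricSpace Y] [MeasurableSpace Y] [BorelSpace Y] (f : X → Y) (s : Set X) (K : ℝ)
    (hK : 0 ≤ K) (h : ∀ x ∈ s, ∀ y ∈ s, dist x y ≤ K * dist (f x) (f y)) :
    μH[2] s ≤ (ENNReal.ofReal K) ^ (2 : ℝ) * μH[2] (f '' s) := by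
  refine hmeas_le_of_antilip f s K.toNNReal fun x hx y hy => ?_
  rw [edist_dist, edist_dist]
  change _ ≤ ENNReal.ofReal K * _
  rw [← ENNReal.ofReal_mul hK]
  exact ENNReal.ofReal_le_ofReal (h x hx y hy)

lemma cone_sub {C : Set E3} {r₀ e₁ e₂ : E3} (hcone : tanCone C r₀ = dihedral e₁ e₂) {x : E3}
    (hx : x ∈ C) : ⟪x - r₀, e₁⟫ ≤ 0 ∧ ⟪x - r₀, e₂⟫ ≤ 0 := by
  have : x - r₀ ∈ tanCone C r₀ := subset_closure ⟨1, x, hx, zero_le_one, by simp⟩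
  rw [hcone] at this
  exact this

/-- Compact parts of the open tangent cone, scaled down, lie in `C`. -/
lemma cone_scale {C : Set E3} {r₀ e₁ e₂ : E3} (hC : IsConvexBody C) (hr₀ : r₀ ∈ C)
    (hcone : tanCone C r₀ = dihedral e₁ e₂) (η M : ℝ) (hη : 0 < η) :
    ∃ t₀ : ℝ, 0 < t₀ ∧ ∀ t, 0 < t → t ≤ t₀ → ∀ z : E3, ⟪z, e₁⟫ ≤ -η → ⟪z, e₂⟫ ≤ -η →
      ‖z‖ ≤ M → r₀ + t • z ∈ C := by
  obtain ⟨hcomp, hconv, c₀, hc₀⟩ := hC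
  set D : Set E3 := {v : E3 | ∃ c : ℝ, ∃ r ∈ C, 0 ≤ c ∧ v = c • (r - r₀)} with hD
  have hDconv : Convex ℝ D := by
    rintro _ ⟨c, r, hr, hc, rfl⟩ _ ⟨c', r', hr', hc', rfl⟩ a b ha hb hab
    by_cases h0 : a * c + b * c' = 0
    · have h1 : a * c = 0 := by nlinarith [mul_nonneg ha hc, mul_nonneg hb hc']
      have h2 : b * c' = 0 := by nlinarith [mul_nonneg ha hc, mul_nonneg hb hc']
      refine ⟨0, r, hr, le_rfl, ?_⟩
      simp [smul_smul, h1, h2]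
    · have hpos : 0 < a * c + b * c' :=
        lt_of_le_of_ne (add_nonneg (mul_nonneg ha hc) (mul_nonneg hb hc')) (Ne.symm h0)
      refine ⟨a * c + b * c', ((a * c) / (a * c + b * c')) • r + ((b * c') / (a * c + b * c')) • r',
        hconv hr hr' (by positivity) (by positivity) (by field_simp), hpos.le, ?_⟩
      rw [smul_sub (a * c + b * c'), smul_add (a * c + b * c'), smul_smul (a * c + b * c'),
        smul_smul (a * c + b * c'), mul_div_cancel₀ _ h0, mul_div_cancel₀ _ h0]
      module
  have hDint : (interior D).Nonempty := by
    refine ⟨c₀ - r₀, ?_⟩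
    have : (fun x : E3 => x + r₀) ⁻¹' (interior C) ⊆ D := by
      intro x hx
      exact ⟨1, x + r₀, interior_subset hx, zero_le_one, by simp⟩
    refine interior_maximal this (isOpen_interior.preimage (by fun_prop)) ?_
    simpa using hc₀
  have hDi : interior (dihedral e₁ e₂) = interior D := by
    rw [← hcone]
    exact hDconv.interior_closure_eq_interior_of_nonempty_interior hDint
  let Z : Set E3 := {z | ⟪z, e₁⟫ ≤ -η ∧ ⟪z, e₂⟫ ≤ -η} ∩ Metric.closedBall 0 M
  have hZ : IsCompact Z := by
    refine (isCompact_closedBall _ _).inter_left ?_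
    have h1 : IsClosed {z : E3 | ⟪z, e₁⟫ ≤ -η} := isClosed_le (by fun_prop) (by fun_prop)
    have h2 : IsClosed {z : E3 | ⟪z, e₂⟫ ≤ -η} := isClosed_le (by fun_prop) (by fun_prop)
    exact h1.inter h2
  let U : ℕ → Set E3 := fun n => interior {z | r₀ + (1 / ((n : ℝ) + 1)) • z ∈ C}
  have key : ∀ (s t : ℝ) (z : E3), 0 < s → s ≤ t → r₀ + t • z ∈ C → r₀ + s • z ∈ C := by
    intro s t z hs hst h
    have ht : 0 < t := hs.trans_le hst
    have := hconv hr₀ h (a := 1 - s / t) (b := s / t)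
      (by rw [sub_nonneg, div_le_one ht]; exact hst) (by positivity) (by ring)
    convert this using 1
    rw [smul_add, smul_smul, div_mul_cancel₀ _ ht.ne']
    module
  have hcov : Z ⊆ ⋃ n, U n := by
    rintro z ⟨⟨h1, h2⟩, -⟩
    have hzi : z ∈ interior D := by
      rw [← hDi]
      refine interior_maximal (t := {z : E3 | ⟪z, e₁⟫ < 0 ∧ ⟪z, e₂⟫ < 0}) ?_ ?_ ?_
      · exact fun x hx => ⟨hx.1.le, hx.2.le⟩
      · have h1 : IsOpen {z : E3 | ⟪z, e₁⟫ < 0} := isOpen_lt (by fun_prop) (by fun_prop)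
        have h2 : IsOpen {z : E3 | ⟪z, e₂⟫ < 0} := isOpen_lt (by fun_prop) (by fun_prop)
        exact h1.inter h2
      · exact ⟨by linarith, by linarith⟩
    have hcont : Tendsto (fun a : ℝ => z - a • (c₀ - r₀)) (𝓝[>] 0) (𝓝 z) := by
      have : Continuous (fun a : ℝ => z - a • (c₀ - r₀)) := by fun_prop
      have h := this.tendsto 0
      simp only [zero_smul, sub_zero] at h
      exact h.mono_left nhdsWithin_le_nhds
    have hev := hcont.eventually (mem_interior_iff_mem_nhds.1 hzi)
    obtain ⟨a, ⟨c, r, hr, hc, hz⟩, ha⟩ := (hev.and self_mem_nhdsWithin).exists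
    have ha : 0 < a := ha
    obtain ⟨n, hn⟩ := exists_nat_gt (a + c)
    refine mem_iUnion.2 ⟨n, ?_⟩
    have hn1 : (0 : ℝ) < (n : ℝ) + 1 := by positivity
    set s : ℝ := 1 / ((n : ℝ) + 1) with hs
    have hs0 : 0 < s := by positivity
    have hsn : s * ((n : ℝ) + 1) = 1 := by rw [hs]; field_simp
    have hsl : s * (a + c) < 1 := by nlinarith
    have hmem : r₀ + s • z ∈ interior C := by
      have hz' : z = a • (c₀ - r₀) + c • (r - r₀) := by rw [← hz]; abel
      have hb : (1 - s * a) > 0 := by nlinarith [mul_nonneg hs0.le hc]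
      have hq : ((1 - s * a - s * c) / (1 - s * a)) • r₀ + ((s * c) / (1 - s * a)) • r ∈ C := by
        refine hconv hr₀ hr ?_ (by positivity) ?_
        · apply div_nonneg _ hb.le; nlinarith
        · field_simp; ring
      have := hconv.combo_interior_self_mem_interior hc₀ hq (a := s * a) (b := 1 - s * a)
        (by positivity) hb.le (by ring)
      convert this using 1
      rw [smul_add, smul_smul, smul_smul, mul_div_cancel₀ _ hb.ne', mul_div_cancel₀ _ hb.ne', hz']
      module
    have hopen : IsOpen ((fun z : E3 => r₀ + s • z) ⁻¹' interior C) :=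
      isOpen_interior.preimage (by fun_prop)
    have hsub : ((fun z : E3 => r₀ + s • z) ⁻¹' interior C) ⊆ {z | r₀ + s • z ∈ C} :=
      fun x hx => interior_subset (s := C) hx
    exact interior_maximal hsub hopen hmem
  have hmono : Monotone U := by
    intro m n hmn
    refine interior_mono ?_
    intro z hz
    refine key _ _ z (by positivity) ?_ hz
    exact one_div_le_one_div_of_le (by positivity) (by exact_mod_cast Nat.succ_le_succ hmn)
  obtain ⟨n, hn⟩ := hZ.elim_directed_cover U (fun _ => isOpen_interior) hcov hmono.directed_le
  refine ⟨1 / ((n : ℝ) + 1), by positivity, fun t ht htn z h1 h2 h3 => ?_⟩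
  have : z ∈ U n := hn ⟨⟨h1, h2⟩, by simpa using h3⟩
  have h' : z ∈ {z | r₀ + (1 / ((n : ℝ) + 1)) • z ∈ C} := interior_subset this
  exact key t _ z ht htn h'

lemma exists_normal {C : Set E3} (hC : IsConvexBody C) {r : E3} (hr : r ∈ frontier C) :
    ∃ n, IsOutwardNormalAt C r n := by
  obtain ⟨hcomp, hconv, hInter⟩ := hC
  obtain ⟨f, hf⟩ := geometric_hahn_banach_open_point hconv.interior isOpen_interior hr.2
  have hle : ∀ x ∈ C, f x ≤ f r := by
    intro x hx
    have : x ∈ closure (interior C) := by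
      rw [hconv.closure_interior_eq_closure_of_nonempty_interior hInter]
      exact subset_closure hx
    exact closure_minimal (t := {x | f x ≤ f r}) (fun y hy => (hf y hy).le)
      (isClosed_le f.continuous continuous_const) this
  set v := (InnerProductSpace.toDual ℝ E3).symm f with hv
  have hfv : ∀ x, f x = ⟪v, x⟫ := fun x => by
    rw [hv, InnerProductSpace.toDual_symm_apply]
  have hv0 : v ≠ 0 := by
    intro h0
    obtain ⟨y, hy⟩ := hInter
    have := hf y hy
    rw [hfv, hfv, h0] at this
    simp at this
  have hvn : 0 < ‖v‖ := norm_pos_iff.2 hv0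
  refine ⟨‖v‖⁻¹ • v, by rw [norm_smul, norm_inv, norm_norm, inv_mul_cancel₀ hvn.ne'], ?_⟩
  intro x hx
  rw [inner_smul_right, real_inner_comm, inner_sub_right, ← hfv, ← hfv]
  have := hle x hx
  exact mul_nonpos_of_nonneg_of_nonpos (by positivity) (by linarith)

lemma normalMap_spec {C : Set E3} {r : E3} (h : IsRegularPt C r) :
    IsOutwardNormalAt C r (normalMap C r) := by
  have h' := h.exists
  rw [normalMap, dif_pos h']
  exact h'.choose_spec

lemma isClosed_normal (C : Set E3) : IsClosed {p : E3 × E3 | IsOutwardNormalAt C p.1 p.2} := by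
  have : {p : E3 × E3 | IsOutwardNormalAt C p.1 p.2} =
      {p | ‖p.2‖ = 1} ∩ ⋂ x ∈ C, {p | ⟪x - p.1, p.2⟫ ≤ 0} := by
    ext p; simp [IsOutwardNormalAt]
  rw [this]
  refine (isClosed_eq (by fun_prop) (by fun_prop)).inter ?_
  exact isClosed_biInter fun x _ => isClosed_le (by fun_prop) (by fun_prop)

lemma isClosed_normal_proj {C : Set E3} (hC : IsCompact C) {F : Set E3} (hF : IsClosed F) :
    IsClosed {r | r ∈ C ∧ ∃ n ∈ F, IsOutwardNormalAt C r n} := by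
  have hK : IsCompact ((C ×ˢ Metric.closedBall (0 : E3) 1) ∩
      ({p : E3 × E3 | IsOutwardNormalAt C p.1 p.2} ∩ Prod.snd ⁻¹' F)) :=
    (hC.prod (isCompact_closedBall _ _)).inter_right
      ((isClosed_normal C).inter (hF.preimage continuous_snd))
  have := (hK.image continuous_fst).isClosed
  convert this using 1
  ext r
  constructor
  · rintro ⟨hr, n, hnF, hn⟩
    exact ⟨(r, n), ⟨⟨hr, by simp [hn.1]⟩, hn, hnF⟩, rfl⟩
  · rintro ⟨⟨r', n⟩, ⟨⟨hr, -⟩, hn, hnF⟩, rfl⟩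
    exact ⟨hr, n, hnF, hn⟩

lemma measurableSet_reg {C : Set E3} (hC : IsCompact C) :
    MeasurableSet (C ∩ {r | IsRegularPt C r}) := by
  have hirr : ∀ m : ℕ, IsClosed {r | r ∈ C ∧ ∃ n n', IsOutwardNormalAt C r n ∧
      IsOutwardNormalAt C r n' ∧ 1 / ((m : ℝ) + 1) ≤ dist n n'} := by
    intro m
    have hcl : IsClosed {p : E3 × E3 × E3 | IsOutwardNormalAt C p.1 p.2.1 ∧
        IsOutwardNormalAt C p.1 p.2.2 ∧ 1 / ((m : ℝ) + 1) ≤ dist p.2.1 p.2.2} :=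
      ((isClosed_normal C).preimage (f := fun p : E3 × E3 × E3 => (p.1, p.2.1)) (by fun_prop)).inter
       (((isClosed_normal C).preimage (f := fun p : E3 × E3 × E3 => (p.1, p.2.2))
        (by fun_prop)).inter (isClosed_le (f := fun _ => 1 / ((m : ℝ) + 1))
          (g := fun p : E3 × E3 × E3 => dist p.2.1 p.2.2) (by fun_prop) (by fun_prop)))
    have hK := ((hC.prod ((isCompact_closedBall (0 : E3) 1).prod
      (isCompact_closedBall (0 : E3) 1))).inter_right hcl)
    have := (hK.image continuous_fst).isClosed
    convert this using 1
    ext r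
    constructor
    · rintro ⟨hr, n, n', hn, hn', hd⟩
      exact ⟨(r, n, n'), ⟨⟨hr, by simp [hn.1], by simp [hn'.1]⟩, hn, hn', hd⟩, rfl⟩
    · rintro ⟨⟨r', n, n'⟩, ⟨⟨hr, -⟩, hn, hn', hd⟩, rfl⟩
      exact ⟨hr, n, n', hn, hn', hd⟩
  have : C ∩ {r | IsRegularPt C r} = {r | r ∈ C ∧ ∃ n ∈ univ, IsOutwardNormalAt C r n} \
      ⋃ m : ℕ, {r | r ∈ C ∧ ∃ n n', IsOutwardNormalAt C r n ∧
      IsOutwardNormalAt C r n' ∧ 1 / ((m : ℝ) + 1) ≤ dist n n'} := by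
    ext r
    constructor
    · rintro ⟨hr, hreg⟩
      refine ⟨⟨hr, hreg.exists.choose, trivial, hreg.exists.choose_spec⟩, ?_⟩
      intro h
      obtain ⟨m, -, n, n', hn, hn', hd⟩ := mem_iUnion.1 h
      rw [hreg.unique hn hn', dist_self] at hd
      have : (0 : ℝ) < 1 / ((m : ℝ) + 1) := by positivity
      linarith
    · rintro ⟨⟨hr, n, -, hn⟩, h⟩
      refine ⟨hr, n, hn, fun n' hn' => ?_⟩
      by_contra hne
      obtain ⟨m, hm⟩ := exists_nat_one_div_lt (dist_pos.2 hne)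
      exact h (mem_iUnion.2 ⟨m, hr, n', n, hn', hn, hm.le⟩)
  rw [this]
  exact (isClosed_normal_proj hC isClosed_univ).measurableSet.diff
    (MeasurableSet.iUnion fun m => (hirr m).measurableSet)

lemma measurableSet_SR {C : Set E3} (hC : IsCompact C) (r₀ e : E3) (t : ℝ) :
    MeasurableSet (Sset C r₀ e t ∩ {r : E3 | IsRegularPt C r}) := by
  have hS : IsClosed (Sset C r₀ e t) :=
    isClosed_frontier.inter (isClosed_le (by fun_prop) (by fun_prop))
  have : Sset C r₀ e t ∩ {r : E3 | IsRegularPt C r} =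
      Sset C r₀ e t ∩ (C ∩ {r : E3 | IsRegularPt C r}) := by
    ext r
    constructor
    · rintro ⟨h, h'⟩
      exact ⟨h, hC.isClosed.frontier_subset h.1, h'⟩
    · rintro ⟨h, -, h'⟩
      exact ⟨h, h'⟩
  rw [this]
  exact hS.measurableSet.inter (measurableSet_reg hC)

lemma aemeasurable_normalMap {C : Set E3} (hC : IsCompact C) (r₀ e : E3) (t : ℝ) :
    AEMeasurable (normalMap C)
      (μH[2].restrict (Sset C r₀ e t ∩ {r : E3 | IsRegularPt C r})) := by
  set R := Sset C r₀ e t ∩ {r : E3 | IsRegularPt C r} with hR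
  have hRm : MeasurableSet R := measurableSet_SR hC r₀ e t
  have hm : Measurable (R.domRestrict (normalMap C)) := by
    refine measurable_of_isClosed fun F hF => ?_
    have : (R.domRestrict (normalMap C)) ⁻¹' F =
        Subtype.val ⁻¹' {r | r ∈ C ∧ ∃ n ∈ F, IsOutwardNormalAt C r n} := by
      ext ⟨r, hr⟩
      constructor
      · intro h
        exact ⟨hC.isClosed.frontier_subset hr.1.1, normalMap C r, h, normalMap_spec hr.2⟩
      · rintro ⟨-, n, hnF, hn⟩
        have : normalMap C r = n := hr.2.unique (normalMap_spec hr.2) hn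
        change normalMap C r ∈ F
        rwa [this]
    rw [this]
    exact measurable_subtype_coe (isClosed_normal_proj hC hF).measurableSet
  exact (aemeasurable_restrict_iff_comap_subtype hRm).2 hm.aemeasurable

/-- The plane orthogonal to `e₁`. -/
abbrev Wsp (e₁ : E3) : Submodule ℝ E3 := (Submodule.span ℝ {e₁})ᗮ

lemma wsp_inner {e₁ : E3} (w : Wsp e₁) : ⟪(w : E3), e₁⟫ = 0 :=
  Submodule.mem_orthogonal_singleton_iff_inner_left.1 w.2

lemma haar_wsp {e₁ : E3} (he₁ : ‖e₁‖ = 1) :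
    (μH[2] : Measure (Wsp e₁)).IsAddHaarMeasure := by
  have : Fact (Module.finrank ℝ E3 = 2 + 1) := ⟨by simp⟩
  have h0 : e₁ ≠ 0 := by
    rintro rfl
    simp at he₁
  have h : Module.finrank ℝ (Wsp e₁) = 2 := Submodule.finrank_orthogonal_span_singleton h0
  have h2 := MeasureTheory.isAddHaarMeasure_hausdorffMeasure (E := Wsp e₁)
  rw [h] at h2
  exact_mod_cast h2

/-- The oblique projection along `d` onto the plane orthogonal to `e₁`. -/
def Qmap (e₁ d : E3) (hd : ⟪d, e₁⟫ = 1) : E3 →L[ℝ] Wsp e₁ :=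
  LinearMap.toContinuousLinearMap
    { toFun := fun x => ⟨x - ⟪x, e₁⟫ • d, by
        rw [Submodule.mem_orthogonal_singleton_iff_inner_left, inner_sub_left, inner_smul_left, hd]
        simp⟩
      map_add' := fun x y => by
        ext1
        simp only [inner_add_left, Submodule.coe_add]
        module
      map_smul' := fun c x => by
        ext1
        simp only [inner_smul_left, Submodule.coe_smul, RingHom.id_apply]
        simp only [conj_trivial]
        module }

lemma Qmap_coe (e₁ d : E3) (hd : ⟪d, e₁⟫ = 1) (x : E3) :
    (Qmap e₁ d hd x : E3) = x - ⟪x, e₁⟫ • d := rfl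

lemma Qmap_eq (e₁ d : E3) (hd : ⟪d, e₁⟫ = 1) (w : Wsp e₁) (s : ℝ) :
    Qmap e₁ d hd ((w : E3) - s • d) = w := by
  ext1
  rw [Qmap_coe, inner_sub_left, inner_smul_left, hd, wsp_inner]
  simp

lemma near_normal_aux {C : Set E3} {e₁ d r r' n : E3} (hd : ⟪d, e₁⟫ = 1) (hr : r ∈ C)
    (hn' : IsOutwardNormalAt C r' n) (h' : 1 / 2 ≤ ⟪d, n⟫) :
    ⟪r - r', e₁⟫ ≤ 2 * ‖Qmap e₁ d hd (r - r')‖ := by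
  have h1 := hn'.2 r hr
  have hdec : r - r' = (Qmap e₁ d hd (r - r') : E3) + ⟪r - r', e₁⟫ • d := by
    rw [Qmap_coe]; abel
  set w := Qmap e₁ d hd (r - r')
  set s := ⟪r - r', e₁⟫
  rw [hdec, inner_add_left, inner_smul_left] at h1
  simp only [conj_trivial] at h1
  have h2 : |⟪(w : E3), n⟫| ≤ ‖w‖ := by
    have := abs_real_inner_le_norm (w : E3) n
    rw [hn'.1, mul_one] at this
    exact this
  have h3 := (abs_le.1 h2).1
  by_contra hcon
  push Not at hcon
  nlinarith [norm_nonneg w]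

lemma near_normal {C : Set E3} {e₁ d r r' n n' : E3} (hd : ⟪d, e₁⟫ = 1) (hr : r ∈ C) (hr' : r' ∈ C)
    (hn : IsOutwardNormalAt C r n) (hn' : IsOutwardNormalAt C r' n')
    (h : 1 / 2 ≤ ⟪d, n⟫) (h' : 1 / 2 ≤ ⟪d, n'⟫) :
    |⟪r - r', e₁⟫| ≤ 2 * ‖Qmap e₁ d hd (r - r')‖ := by
  refine abs_le'.2 ⟨near_normal_aux hd hr hn' h', ?_⟩
  have := near_normal_aux hd hr' hn h
  rw [← neg_sub r r', inner_neg_left, map_neg, norm_neg] at this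
  exact this

lemma finite_near {C : Set E3} {e₁ d : E3} (he₁ : ‖e₁‖ = 1) (hC : IsCompact C)
    (hd : ⟪d, e₁⟫ = 1) :
    μH[2] {r | r ∈ C ∧ ∃ n, IsOutwardNormalAt C r n ∧ 1 / 2 ≤ ⟪d, n⟫} < ⊤ := by
  have := haar_wsp he₁
  set N := {r | r ∈ C ∧ ∃ n, IsOutwardNormalAt C r n ∧ 1 / 2 ≤ ⟪d, n⟫} with hN
  have hle := hmeas_le_of_antilip_real (Qmap e₁ d hd) N (1 + 2 * ‖d‖) (by positivity) (by
    rintro r ⟨hr, n, hn, h⟩ r' ⟨hr', n', hn', h'⟩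
    have h1 := near_normal hd hr hr' hn hn' h h'
    rw [dist_eq_norm, dist_eq_norm, ← map_sub]
    have hdec : r - r' = (Qmap e₁ d hd (r - r') : E3) + ⟪r - r', e₁⟫ • d := by
      rw [Qmap_coe]; abel
    calc ‖r - r'‖ = ‖(Qmap e₁ d hd (r - r') : E3) + ⟪r - r', e₁⟫ • d‖ := by rw [← hdec]
      _ ≤ ‖Qmap e₁ d hd (r - r')‖ + |⟪r - r', e₁⟫| * ‖d‖ := by
        refine (norm_add_le _ _).trans ?_
        rw [norm_smul]; rfl
      _ ≤ ‖Qmap e₁ d hd (r - r')‖ + (2 * ‖Qmap e₁ d hd (r - r')‖) * ‖d‖ := by gcongr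
      _ = (1 + 2 * ‖d‖) * ‖Qmap e₁ d hd (r - r')‖ := by ring)
  refine hle.trans_lt (ENNReal.mul_lt_top (by simp) ?_)
  refine lt_of_le_of_lt (measure_mono (image_mono (fun r hr => hr.1))) ?_
  exact (hC.image (Qmap e₁ d hd).continuous).measure_lt_top

lemma ae_regular {C : Set E3} {r₀ e₁ d : E3} (he₁ : ‖e₁‖ = 1) (hC : IsConvexBody C)
    (hd : ⟪d, e₁⟫ = 1) (V : Set (Wsp e₁)) (hV : IsOpen V) (g : Wsp e₁ → ℝ)
    (hg : ∀ p ∈ V, r₀ + p - g p • d ∈ frontier C)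
    (hn : ∀ p ∈ V, ∀ n, IsOutwardNormalAt C (r₀ + p - g p • d) n → 1 / 2 ≤ ⟪d, n⟫) :
    ∀ᵐ p ∂(μH[2] : Measure (Wsp e₁)), p ∈ V → IsRegularPt C (r₀ + p - g p • d) := by
  have := haar_wsp he₁
  have hsub : ∀ p q : Wsp e₁, (r₀ + (p : E3) - g p • d) - (r₀ + q - g q • d) =
      ((p - q : Wsp e₁) : E3) - (g p - g q) • d := by
    intro p q
    rw [Submodule.coe_sub]
    module
  have hlip : LipschitzOnWith 2 g V := by
    refine LipschitzOnWith.of_dist_le_mul fun p hp q hq => ?_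
    obtain ⟨n, hnn⟩ := exists_normal hC (hg p hp)
    obtain ⟨n', hnn'⟩ := exists_normal hC (hg q hq)
    have h := near_normal hd (hC.1.isClosed.frontier_subset (hg p hp))
      (hC.1.isClosed.frontier_subset (hg q hq)) hnn hnn' (hn p hp n hnn) (hn q hq n' hnn')
    rw [hsub, Qmap_eq, inner_sub_left, wsp_inner, inner_smul_left, hd] at h
    simp only [conj_trivial, mul_one, zero_sub, abs_neg] at h
    rw [Real.dist_eq, dist_eq_norm]
    exact h
  filter_upwards [hlip.ae_differentiableWithinAt_of_mem (μ := (μH[2] : Measure (Wsp e₁)))]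
    with p hp hpV
  have hdiff : DifferentiableAt ℝ g p := (hp hpV).differentiableAt (hV.mem_nhds hpV)
  obtain ⟨n₀, hn₀⟩ := exists_normal hC (hg p hpV)
  -- every normal satisfies the stationarity condition
  have hstat : ∀ n, IsOutwardNormalAt C (r₀ + p - g p • d) n → ∀ v : Wsp e₁,
      ⟪(v : E3), n⟫ = fderiv ℝ g p v * ⟪d, n⟫ := by
    intro n hnn v
    let L : Wsp e₁ →L[ℝ] ℝ := (innerSL ℝ n).comp (Wsp e₁).subtypeL
    have hL : ∀ w : Wsp e₁, L w = ⟪(w : E3), n⟫ := fun w => by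
      rw [real_inner_comm]; rfl
    have hmax : IsLocalMax (fun q : Wsp e₁ => L q - g q * ⟪d, n⟫) p := by
      filter_upwards [hV.mem_nhds hpV] with q hq
      have h := hnn.2 _ (hC.1.isClosed.frontier_subset (hg q hq))
      rw [hsub, inner_sub_left, inner_smul_left, Submodule.coe_sub, inner_sub_left] at h
      simp only [conj_trivial] at h
      rw [hL, hL]
      linarith
    have hder : HasFDerivAt (fun q : Wsp e₁ => L q - g q * ⟪d, n⟫)
        (L - ⟪d, n⟫ • fderiv ℝ g p) p :=
      L.hasFDerivAt.sub (hdiff.hasFDerivAt.mul_const _)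
    have h0 := hmax.hasFDerivAt_eq_zero hder
    have h1 := congrArg (fun f : Wsp e₁ →L[ℝ] ℝ => f v) h0
    simp only [_root_.sub_apply, _root_.smul_apply, smul_eq_mul, hL,
      _root_.zero_apply] at h1
    linarith
  refine ⟨n₀, hn₀, fun n hnn => ?_⟩
  have ha := hn p hpV n hnn
  have ha₀ := hn p hpV n₀ hn₀
  have heq : ⟪d, n₀⟫ • n = ⟪d, n⟫ • n₀ := by
    refine ext_inner_left ℝ fun x => ?_
    have hdec : x = (Qmap e₁ d hd x : E3) + ⟪x, e₁⟫ • d := by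
      rw [Qmap_coe]; abel
    rw [hdec]
    simp only [inner_add_left, inner_smul_left, inner_smul_right]
    rw [hstat n hnn, hstat n₀ hn₀]
    ring
  have hnorm := congrArg norm heq
  rw [norm_smul, norm_smul, hn₀.1, hnn.1, mul_one, mul_one, Real.norm_eq_abs, Real.norm_eq_abs,
    abs_of_pos (by linarith), abs_of_pos (by linarith)] at hnorm
  rw [hnorm] at heq
  exact smul_right_injective E3 (r := ⟪d, n⟫) (by linarith) heq

lemma normal_close {C : Set E3} {r₀ e₁ d n : E3} (he₁ : ‖e₁‖ = 1) (hd : ⟪d, e₁⟫ = 1)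
    {ε t σ γ δ : ℝ} (hσ : 0 < σ) (hε : ε < 1) (ht : 0 < t) (hγ0 : 0 ≤ γ) (hγ : γ ≤ ε * t)
    (hδ : 0 < δ)
    (p : Wsp e₁) (hn : IsOutwardNormalAt C (r₀ + p - γ • d) n)
    (h1 : ∀ v : Wsp e₁, ‖v‖ ≤ σ → r₀ + (p + v : Wsp e₁) - (ε * t) • d ∈ C)
    (h2 : r₀ + p - t • d ∈ C)
    (hs1 : 2 * (ε * t * ‖d‖) < δ ^ 2 * σ) (hs2 : ε * t * ‖d‖ * (1 + ‖d‖ ^ 2) < σ) :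
    ‖n - e₁‖ < δ := by
  have hε0 : 0 ≤ ε * t := hγ0.trans hγ
  have hee : ⟪e₁, e₁⟫ = 1 := by rw [real_inner_self_eq_norm_sq, he₁]; norm_num
  set m : Wsp e₁ := Qmap e₁ e₁ hee n with hm
  set x : ℝ := ⟪n, e₁⟫ with hx
  have hdec : n = (m : E3) + x • e₁ := by rw [hm, Qmap_coe]; abel
  have hnn : ‖m‖ ^ 2 + x ^ 2 = 1 := by
    have := real_inner_self_eq_norm_sq n
    rw [hn.1] at this
    nth_rewrite 1 [hdec] at this
    nth_rewrite 1 [hdec] at this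
    rw [inner_add_left, inner_add_right, inner_add_right, inner_smul_left, inner_smul_right,
      inner_smul_left, inner_smul_right, real_inner_comm (m : E3) e₁, wsp_inner, hee,
      real_inner_self_eq_norm_sq] at this
    simp only [conj_trivial] at this
    rw [Submodule.norm_coe] at this
    nlinarith
  have hmn : ⟪(m : E3), n⟫ = ‖m‖ ^ 2 := by
    rw [hdec, inner_add_right, inner_smul_right, wsp_inner, real_inner_self_eq_norm_sq,
      Submodule.norm_coe]
    ring
  have hm1 : ‖m‖ ≤ 1 := by
    have := norm_nonneg m
    nlinarith [sq_nonneg x]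
  have hdn : ⟪d, n⟫ ≤ ‖d‖ := by
    have := real_inner_le_norm d n
    rwa [hn.1, mul_one] at this
  have hdn0 : 0 ≤ ⟪d, n⟫ := by
    have h := hn.2 _ h2
    have e1 : r₀ + (p : E3) - t • d - (r₀ + p - γ • d) = (γ - t) • d := by module
    rw [e1, inner_smul_left] at h
    simp only [conj_trivial] at h
    have : γ < t := by nlinarith
    by_contra hc
    push Not at hc
    nlinarith
  have hm2 : σ * ‖m‖ ^ 2 ≤ ε * t * ‖d‖ := by
    have h := hn.2 _ (h1 (σ • m) (by
      rw [norm_smul, Real.norm_eq_abs, abs_of_pos hσ]; nlinarith))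
    have e1 : r₀ + ((p + σ • m : Wsp e₁) : E3) - (ε * t) • d - (r₀ + p - γ • d) =
        σ • (m : E3) - (ε * t - γ) • d := by
      rw [Submodule.coe_add, Submodule.coe_smul]; module
    rw [e1, inner_sub_left, inner_smul_left, inner_smul_left, hmn] at h
    simp only [conj_trivial] at h
    nlinarith [norm_nonneg d]
  have hxl : -(‖d‖ * ‖m‖) ≤ x := by
    have h3 : ⟪d, n⟫ = ⟪d, (m : E3)⟫ + x := by
      rw [hdec, inner_add_right, inner_smul_right, hd, mul_one]
    have := real_inner_le_norm d (m : E3)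
    rw [Submodule.norm_coe] at this
    linarith
  have hxpos : 0 < x := by
    by_contra hc
    push Not at hc
    have h5 : x ^ 2 ≤ ‖d‖ ^ 2 * ‖m‖ ^ 2 := by nlinarith
    have h6 : σ * 1 ≤ σ * (‖m‖ ^ 2 * (1 + ‖d‖ ^ 2)) :=
      mul_le_mul_of_nonneg_left (by nlinarith) hσ.le
    have h7 : σ * ‖m‖ ^ 2 * (1 + ‖d‖ ^ 2) ≤ ε * t * ‖d‖ * (1 + ‖d‖ ^ 2) :=
      mul_le_mul_of_nonneg_right hm2 (by positivity)
    linarith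
  have hx1 : x ≤ 1 := by nlinarith [sq_nonneg ‖m‖]
  have hfin : ‖n - e₁‖ ^ 2 < δ ^ 2 := by
    rw [norm_sub_sq_real, hn.1, he₁, ← hx]
    have h8 : 1 - ‖m‖ ^ 2 ≤ x := by nlinarith
    have h9 : σ * (2 * ‖m‖ ^ 2) < σ * δ ^ 2 := by nlinarith
    have h10 := lt_of_mul_lt_mul_left h9 hσ.le
    nlinarith
  exact lt_of_pow_lt_pow_left₀ 2 hδ.le hfin

lemma comb_mem {C : Set E3} {r₀ e₁ e₂ e d : E3} {lam₁ lam₂ : ℝ} (hC : IsConvexBody C)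
    (hr₀ : r₀ ∈ C) (he₂ : ‖e₂‖ = 1)
    (hcone : tanCone C r₀ = dihedral e₁ e₂) (hl₂ : 0 < lam₂)
    (he : e = lam₁ • e₁ + lam₂ • e₂) (hd : ⟪d, e₁⟫ = 1) (hd₂ : ⟪d, e₂⟫ = 1)
    {ω ε θ : ℝ} (hω : 0 < ω) (hε : 0 < ε) (hθ : 0 < θ) (hθ4 : θ ≤ 1 / 4)
    (hθε : θ ≤ ε * lam₁ / 2) (w₀ : Wsp e₁) (hw₀ : ⟪(w₀ : E3), e₂⟫ = -ω) :
    ∃ t₀ : ℝ, 0 < t₀ ∧ ∀ t, 0 < t → t ≤ t₀ → ∀ r ∈ Bset C r₀ e t, ∀ v : Wsp e₁,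
      ‖v‖ ≤ ω / 2 * t → ∀ b, ε ≤ b → b ≤ 1 →
      r₀ + ((t • w₀ + θ • Qmap e₁ d hd (r - r₀) + v : Wsp e₁) : E3) - (b * t) • d ∈ C := by
  obtain ⟨t₀, ht₀, H⟩ := cone_scale hC hr₀ hcone (min (ε / 2) (ω / 2))
    (2 * (‖w₀‖ + ω / 2 + ‖d‖)) (by positivity)
  refine ⟨t₀, ht₀, fun t ht htt r hr v hv b hb hb1 => ?_⟩
  obtain ⟨hrC, hrt⟩ := hr
  obtain ⟨hr1, hr2⟩ := cone_sub hcone hrC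
  have hrt : ⟪r - r₀, e⟫ = -t := hrt
  rw [he, inner_add_right, inner_smul_right, inner_smul_right] at hrt
  set β : ℝ := -⟪r - r₀, e₁⟫ / t with hβ
  have hβt : ⟪r - r₀, e₁⟫ = -(β * t) := by rw [hβ]; field_simp
  have hβ0 : 0 ≤ β := div_nonneg (by linarith) ht.le
  have hβ1 : lam₁ * β ≤ 1 := by
    have : lam₁ * β * t ≤ 1 * t := by
      rw [hβt] at hrt
      nlinarith
    exact le_of_mul_le_mul_right this ht
  have hθβ : θ * β ≤ ε / 2 := by
    have := mul_le_mul_of_nonneg_right hθε hβ0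
    nlinarith
  have hθβ0 : 0 ≤ θ * β := by positivity
  set a : ℝ := (1 - θ)⁻¹ with ha
  have hθ1 : 0 < 1 - θ := by linarith
  have ha1 : 1 ≤ a := by rw [ha]; exact (one_le_inv₀ hθ1).2 (by linarith)
  have ha2 : a ≤ 2 := by
    rw [ha]
    exact inv_le_of_inv_le₀ (by norm_num) (by norm_num; linarith)
  have ha3 : (1 - θ) * a = 1 := mul_inv_cancel₀ hθ1.ne'
  set z : E3 := a • ((w₀ : E3) + t⁻¹ • (v : E3) - (b - θ * β) • d) with hz
  have hvt : ‖t⁻¹ • (v : E3)‖ ≤ ω / 2 := by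
    rw [norm_smul, norm_inv, Real.norm_eq_abs, abs_of_pos ht, inv_mul_le_iff₀ ht]
    rw [Submodule.norm_coe]
    linarith
  have hz1 : ⟪z, e₁⟫ ≤ -min (ε / 2) (ω / 2) := by
    rw [hz, inner_smul_left, inner_sub_left, inner_add_left, inner_smul_left, inner_smul_left,
      wsp_inner, wsp_inner, hd]
    simp only [conj_trivial]
    have := min_le_left (ε / 2) (ω / 2)
    nlinarith
  have hz2 : ⟪z, e₂⟫ ≤ -min (ε / 2) (ω / 2) := by
    have h := real_inner_le_norm (t⁻¹ • (v : E3)) e₂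
    rw [he₂, mul_one] at h
    rw [hz, inner_smul_left, inner_sub_left, inner_add_left, inner_smul_left d, hw₀, hd₂]
    simp only [conj_trivial]
    have := min_le_right (ε / 2) (ω / 2)
    have h2 : -ω + ⟪t⁻¹ • (v : E3), e₂⟫ - (b - θ * β) * 1 ≤ - (ω / 2) := by linarith
    nlinarith
  have hz3 : ‖z‖ ≤ 2 * (‖w₀‖ + ω / 2 + ‖d‖) := by
    rw [hz, norm_smul, Real.norm_eq_abs, abs_of_pos (by linarith)]
    have h1 : ‖(w₀ : E3) + t⁻¹ • (v : E3) - (b - θ * β) • d‖ ≤ ‖w₀‖ + ω / 2 + ‖d‖ := by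
      refine (norm_sub_le _ _).trans ?_
      refine add_le_add ((norm_add_le _ _).trans (add_le_add le_rfl hvt)) ?_
      rw [norm_smul, Real.norm_eq_abs, abs_of_nonneg (by linarith)]
      nlinarith [norm_nonneg d]
    exact mul_le_mul ha2 h1 (norm_nonneg _) (by norm_num)
  have hmem := hC.2.1 (H t ht htt z hz1 hz2 hz3) hrC hθ1.le hθ.le (by ring)
  convert hmem using 1
  rw [smul_add, smul_smul, hz, smul_smul]
  have hc : (1 - θ) * t * a = t := by rw [mul_right_comm, ha3, one_mul]
  rw [hc, smul_sub, smul_add, smul_smul t t⁻¹, mul_inv_cancel₀ ht.ne']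
  simp only [Submodule.coe_add, Submodule.coe_smul, Qmap_coe]
  rw [hβt]
  module

lemma g_spec {C : Set E3} {r₀ e₁ d : E3} (hC : IsCompact C)
    (hle : ∀ x ∈ C, ⟪x - r₀, e₁⟫ ≤ 0) (hd : ⟪d, e₁⟫ = 1) (q : Wsp e₁) (s : ℝ)
    (hs : r₀ + q - s • d ∈ C) :
    0 ≤ sInf {s : ℝ | r₀ + q - s • d ∈ C} ∧ sInf {s : ℝ | r₀ + q - s • d ∈ C} ≤ s ∧
      r₀ + q - (sInf {s : ℝ | r₀ + q - s • d ∈ C}) • d ∈ frontier C := by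
  set S : Set ℝ := {s : ℝ | r₀ + q - s • d ∈ C} with hS
  have hlow : ∀ s ∈ S, 0 ≤ s := by
    intro s hs
    have h := hle _ hs
    have e1 : r₀ + (q : E3) - s • d - r₀ = q - s • d := by abel
    rw [e1, inner_sub_left, wsp_inner, inner_smul_left, hd] at h
    simp only [conj_trivial] at h
    linarith
  have hbdd : BddBelow S := ⟨0, hlow⟩
  have hcl : IsClosed S := hC.isClosed.preimage (f := fun s : ℝ => r₀ + (q : E3) - s • d)
    (by fun_prop)
  have hmem : sInf S ∈ S := hcl.csInf_mem ⟨s, hs⟩ hbdd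
  refine ⟨hlow _ hmem, csInf_le hbdd hs, ?_⟩
  rw [hC.isClosed.frontier_eq]
  refine ⟨hmem, fun hInter => ?_⟩
  have hcont : Tendsto (fun a : ℝ => r₀ + (q : E3) - (sInf S - a) • d) (𝓝[>] 0)
      (𝓝 (r₀ + q - sInf S • d)) := by
    have : Continuous (fun a : ℝ => r₀ + (q : E3) - (sInf S - a) • d) := by fun_prop
    have h := this.tendsto 0
    simp only [sub_zero] at h
    exact h.mono_left nhdsWithin_le_nhds
  obtain ⟨a, ha, ha0⟩ := ((hcont.eventually (mem_interior_iff_mem_nhds.1 hInter)).and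
    self_mem_nhdsWithin).exists
  have ha0 : 0 < a := ha0
  have : sInf S ≤ sInf S - a := csInf_le hbdd ha
  linarith

lemma B_pos {C : Set E3} {r₀ e₁ e₂ e d : E3} {lam₁ lam₂ : ℝ} (hC : IsConvexBody C)
    (hr₀ : r₀ ∈ C) (he₁ : ‖e₁‖ = 1) (he₂ : ‖e₂‖ = 1) (hnorm : ‖e‖ = 1)
    (hcone : tanCone C r₀ = dihedral e₁ e₂) (hl₁ : 0 < lam₁) (hl₂ : 0 < lam₂)
    (he : e = lam₁ • e₁ + lam₂ • e₂) (hd : ⟪d, e₁⟫ = 1) (hd₂ : ⟪d, e₂⟫ = 1) :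
    ∃ t₀ : ℝ, 0 < t₀ ∧ ∀ t, 0 < t → t ≤ t₀ → 0 < μH[2] (Bset C r₀ e t) := by
  have := haar_wsp he₁
  set Λ : ℝ := lam₁ + lam₂ with hΛ
  have hΛ0 : 0 < Λ := by positivity
  have hde : ⟪d, e⟫ = Λ := by
    rw [he, inner_add_right, inner_smul_right, inner_smul_right, hd, hd₂]; ring
  -- a small radius
  set κ : ℝ := (1 / (2 * Λ)) / (1 + ‖d‖ / Λ) with hκ
  have hκ0 : 0 < κ := by positivity
  obtain ⟨t₀, ht₀, H⟩ := cone_scale hC hr₀ hcone (1 / (2 * Λ))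
    (1 / Λ * ‖d‖ + 1 / (2 * Λ)) (by positivity)
  refine ⟨t₀, ht₀, fun t ht htt => ?_⟩
  have hsub : Metric.ball (0 : Wsp e₁) (κ * t) ⊆
      (fun r => Qmap e₁ d hd (r - r₀)) '' (Bset C r₀ e t) := by
    intro w hw
    have hw : ‖w‖ < κ * t := by simpa using hw
    set u : E3 := t⁻¹ • ((w : E3) - (⟪(w : E3), e⟫ / Λ) • d) with hu
    have hwe : |⟪(w : E3), e⟫| ≤ ‖w‖ := by
      have := abs_real_inner_le_norm (w : E3) e
      rwa [hnorm, mul_one] at this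
    have hun : ‖u‖ ≤ 1 / (2 * Λ) := by
      rw [hu, norm_smul, norm_inv, Real.norm_eq_abs, abs_of_pos ht, inv_mul_le_iff₀ ht]
      calc ‖(w : E3) - (⟪(w : E3), e⟫ / Λ) • d‖ ≤ ‖w‖ + |⟪(w : E3), e⟫| / Λ * ‖d‖ := by
            refine (norm_sub_le _ _).trans ?_
            rw [norm_smul, norm_div, Real.norm_eq_abs, Real.norm_eq_abs, abs_of_pos hΛ0]
            rfl
        _ ≤ ‖w‖ + ‖w‖ / Λ * ‖d‖ := by gcongr
        _ = ‖w‖ * (1 + ‖d‖ / Λ) := by ring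
        _ ≤ (κ * t) * (1 + ‖d‖ / Λ) := by gcongr
        _ = t * (1 / (2 * Λ)) := by rw [hκ]; field_simp
    have hz : ∀ f : E3, ‖f‖ = 1 → ⟪d, f⟫ = 1 → ⟪-(1 / Λ) • d + u, f⟫ ≤ -(1 / (2 * Λ)) := by
      intro f hf hdf
      have h := real_inner_le_norm u f
      rw [hf, mul_one] at h
      rw [inner_add_left, inner_smul_left, hdf]
      simp only [conj_trivial]
      have : 1 / Λ = 1 / (2 * Λ) + 1 / (2 * Λ) := by field_simp; norm_num
      linarith
    have hmem := H t ht htt (-(1 / Λ) • d + u) (hz e₁ he₁ hd) (hz e₂ he₂ hd₂) (by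
      refine (norm_add_le _ _).trans (add_le_add ?_ hun)
      rw [norm_smul, norm_neg, Real.norm_eq_abs, abs_of_pos (by positivity)])
    have hexp : t • (-(1 / Λ) • d + u) = (w : E3) - (t / Λ + ⟪(w : E3), e⟫ / Λ) • d := by
      rw [smul_add, hu, smul_smul t t⁻¹, mul_inv_cancel₀ ht.ne', one_smul, smul_smul]
      have : t * -(1 / Λ) = -(t / Λ) := by ring
      rw [this]
      module
    refine ⟨_, ⟨hmem, ?_⟩, ?_⟩
    · change ⟪r₀ + t • (-(1 / Λ) • d + u) - r₀, e⟫ = -t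
      rw [add_sub_cancel_left, hexp, inner_sub_left, inner_smul_left, hde]
      simp only [conj_trivial]
      field_simp
      ring
    · change Qmap e₁ d hd (r₀ + t • (-(1 / Λ) • d + u) - r₀) = w
      rw [add_sub_cancel_left, hexp, Qmap_eq]
  have hlip : LipschitzWith ‖Qmap e₁ d hd‖₊ (fun r => Qmap e₁ d hd (r - r₀)) := by
    refine LipschitzWith.of_dist_le_mul fun x y => ?_
    rw [dist_eq_norm, ← map_sub, sub_sub_sub_cancel_right, dist_eq_norm]
    exact (Qmap e₁ d hd).le_opNorm _
  have h1 := hlip.hausdorffMeasure_image_le (d := 2) (by norm_num) (Bset C r₀ e t)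
  have h2 : 0 < μH[2] (Metric.ball (0 : Wsp e₁) (κ * t)) :=
    Metric.measure_ball_pos _ _ (by positivity)
  by_contra hcon
  have h0 : μH[2] (Bset C r₀ e t) = 0 := by simpa using hcon
  rw [h0, mul_zero] at h1
  exact absurd (h2.trans_le ((measure_mono hsub).trans h1)) (lt_irrefl _)

lemma level_arith {l₁ l₂ t θ ω x₁ x₂ G Λ ε : ℝ} (hl₁ : 0 < l₁) (hl₂ : 0 < l₂) (ht : 0 < t)
    (hθ0 : 0 ≤ θ) (hθ4 : θ ≤ 1 / 4) (hω : l₂ * ω = 1 / 2) (hx₁ : x₁ ≤ 0) (_hx₂ : x₂ ≤ 0)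
    (hx : l₁ * x₁ + l₂ * x₂ = -t) (hΛ : 0 ≤ Λ) (hG : G ≤ ε * t) (hε : ε * Λ ≤ 1 / 4) :
    -t ≤ l₂ * (-(t * ω) + θ * (x₂ - x₁)) - G * Λ := by
  have h3 : G * Λ ≤ t * (1 / 4) := by
    have h := mul_le_mul_of_nonneg_right hG hΛ
    have h' := mul_le_mul_of_nonneg_left hε ht.le
    linarith
  have h4 : -t ≤ l₂ * x₂ := by
    have := mul_nonpos_of_nonneg_of_nonpos hl₁.le hx₁
    linarith
  have h5 : -(t * (1 / 4)) ≤ θ * (l₂ * x₂) := by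
    have h := mul_le_mul_of_nonneg_left h4 hθ0
    have h' := mul_le_mul_of_nonneg_right hθ4 ht.le
    linarith
  have h6 : 0 ≤ θ * l₂ * (-x₁) := mul_nonneg (by positivity) (by linarith)
  have h7 : l₂ * (t * ω) = t * (1 / 2) := by rw [← hω]; ring
  have h8 : l₂ * (-(t * ω) + θ * (x₂ - x₁)) = -(l₂ * (t * ω)) + θ * (l₂ * x₂) + θ * l₂ * (-x₁) := by
    ring
  rw [h8]
  linarith

set_option maxHeartbeats 2000000 in
lemma main_area {C : Set E3} {r₀ e₁ e₂ e d : E3} {lam₁ lam₂ : ℝ} (hC : IsConvexBody C)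
    (hr₀ : r₀ ∈ C) (he₁ : ‖e₁‖ = 1) (he₂ : ‖e₂‖ = 1) (hnorm : ‖e‖ = 1)
    (hcone : tanCone C r₀ = dihedral e₁ e₂) (hl₁ : 0 < lam₁) (hl₂ : 0 < lam₂)
    (he : e = lam₁ • e₁ + lam₂ • e₂) (hd : ⟪d, e₁⟫ = 1) (hd₂ : ⟪d, e₂⟫ = 1)
    (w₀ : Wsp e₁) (hw₀ : ⟪(w₀ : E3), e₂⟫ = -(1 / (2 * lam₂)))
    {δ : ℝ} (hδ : 0 < δ) (hδd : ∀ n : E3, ‖n - e₁‖ < δ → 1 / 2 ≤ ⟪d, n⟫) :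
    ∃ K : ℝ≥0∞, K ≠ ⊤ ∧ ∃ t₀ : ℝ, 0 < t₀ ∧ ∀ t, 0 < t → t ≤ t₀ →
      μH[2] (Bset C r₀ e t) < ⊤ ∧
      μH[2] (Bset C r₀ e t) ≤ K * μH[2] {r | r ∈ Sset C r₀ e t ∩ {r | IsRegularPt C r} ∧
        ‖normalMap C r - e₁‖ < δ} := by
  have := haar_wsp he₁
  set Λ : ℝ := lam₁ + lam₂ with hΛ
  have hΛ0 : 0 < Λ := by positivity
  have hde : ⟪d, e⟫ = Λ := by
    rw [he, inner_add_right, inner_smul_right, inner_smul_right, hd, hd₂]; ring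
  set ω : ℝ := 1 / (2 * lam₂) with hω
  have hω0 : 0 < ω := by positivity
  have hωl : lam₂ * ω = 1 / 2 := by rw [hω]; field_simp
  -- choice of the small parameters
  have hsmall : ∀ a b : ℝ, 0 < b → ∀ᶠ ε in 𝓝[>] (0 : ℝ), ε * a < b := by
    intro a b hb
    have h : Tendsto (fun ε : ℝ => ε * a) (𝓝[>] 0) (𝓝 0) := by
      have : Continuous (fun ε : ℝ => ε * a) := by fun_prop
      have h := this.tendsto 0
      simp only [zero_mul] at h
      exact h.mono_left nhdsWithin_le_nhds
    exact h.eventually (gt_mem_nhds hb)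
  obtain ⟨ε, ⟨⟨⟨hε1, hεΛ⟩, hεs1⟩, hεs2⟩, hε0⟩ :=
    ((((hsmall 1 1 one_pos).and (hsmall Λ (1 / 4) (by norm_num))).and
    (hsmall (2 * ‖d‖) (δ ^ 2 * (ω / 4)) (by positivity))).and
    (hsmall (‖d‖ * (1 + ‖d‖ ^ 2)) (ω / 4) (by positivity))).and self_mem_nhdsWithin |>.exists
  have hε0 : 0 < ε := hε0
  rw [mul_one] at hε1
  set θ : ℝ := min (1 / 4) (ε * lam₁ / 2) with hθ
  have hθ0 : 0 < θ := by positivity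
  have hθ4 : θ ≤ 1 / 4 := min_le_left _ _
  have hθε : θ ≤ ε * lam₁ / 2 := min_le_right _ _
  obtain ⟨t₀, ht₀, H⟩ := comb_mem hC hr₀ he₂ hcone hl₂ he hd hd₂ hω0 hε0 hθ0 hθ4 hθε w₀ hw₀
  set L : ℝ := (1 + ‖d‖ / Λ) / θ with hL
  have hL0 : 0 ≤ L := by positivity
  have hlip : LipschitzWith ‖Qmap e₁ d hd‖₊ (fun r => Qmap e₁ d hd (r - r₀)) := by
    refine LipschitzWith.of_dist_le_mul fun x y => ?_
    rw [dist_eq_norm, ← map_sub, sub_sub_sub_cancel_right, dist_eq_norm]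
    exact (Qmap e₁ d hd).le_opNorm _
  refine ⟨(ENNReal.ofReal L) ^ (2 : ℝ) * (‖Qmap e₁ d hd‖₊ : ℝ≥0∞) ^ (2 : ℝ), ?_, t₀, ht₀,
    fun t ht htt => ?_⟩
  · exact ENNReal.mul_ne_top (by simp) (by simp)
  set B := Bset C r₀ e t with hB
  let φ : E3 → Wsp e₁ := fun r => t • w₀ + θ • Qmap e₁ d hd (r - r₀)
  have hanti : μH[2] B ≤ (ENNReal.ofReal L) ^ (2 : ℝ) * μH[2] (φ '' B) := by
    refine hmeas_le_of_antilip_real φ B L hL0 fun r hr r' hr' => ?_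
    have hx : ⟪r - r', e⟫ = 0 := by
      have h1 : ⟪r - r₀, e⟫ = -t := hr.2
      have h2 : ⟪r' - r₀, e⟫ = -t := hr'.2
      rw [← sub_sub_sub_cancel_right r r' r₀, inner_sub_left, h1, h2, sub_self]
    have hφ : φ r - φ r' = θ • Qmap e₁ d hd (r - r') := by
      change (t • w₀ + θ • Qmap e₁ d hd (r - r₀)) - (t • w₀ + θ • Qmap e₁ d hd (r' - r₀)) = _
      rw [add_sub_add_left_eq_sub, ← smul_sub, ← map_sub, sub_sub_sub_cancel_right]
    rw [dist_eq_norm, dist_eq_norm, hφ, norm_smul, Real.norm_eq_abs, abs_of_pos hθ0]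
    have hdec : r - r' = (Qmap e₁ d hd (r - r') : E3) + ⟪r - r', e₁⟫ • d := by
      rw [Qmap_coe]; abel
    set w := Qmap e₁ d hd (r - r')
    set s := ⟪r - r', e₁⟫
    rw [hdec, inner_add_left, inner_smul_left, hde] at hx
    simp only [conj_trivial] at hx
    have hwe : |⟪(w : E3), e⟫| ≤ ‖w‖ := by
      have := abs_real_inner_le_norm (w : E3) e
      rwa [hnorm, mul_one] at this
    have hs : |s| ≤ ‖w‖ / Λ := by
      rw [le_div_iff₀ hΛ0]
      have : |s| * Λ = |⟪(w : E3), e⟫| := by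
        have h0 : |s| * Λ = |s * Λ| := by rw [abs_mul, abs_of_pos hΛ0]
        rw [h0]
        have : s * Λ = -⟪(w : E3), e⟫ := by linarith
        rw [this, abs_neg]
      rw [this]
      exact hwe
    rw [hdec]
    calc ‖(w : E3) + s • d‖ ≤ ‖w‖ + |s| * ‖d‖ := by
          refine (norm_add_le _ _).trans ?_
          rw [norm_smul]; rfl
      _ ≤ ‖w‖ + ‖w‖ / Λ * ‖d‖ := by gcongr
      _ = L * (θ * ‖w‖) := by rw [hL]; field_simp
  have hfin : μH[2] (φ '' B) < ⊤ := by
    have hcont : Continuous φ := by fun_prop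
    exact lt_of_le_of_lt (measure_mono (image_mono inter_subset_left))
      (hC.1.image hcont).measure_lt_top
  refine ⟨hanti.trans_lt (ENNReal.mul_lt_top (by simp) hfin), ?_⟩
  rw [mul_assoc]
  refine hanti.trans (mul_le_mul_right ?_ _)
  set A := {r | r ∈ Sset C r₀ e t ∩ {r | IsRegularPt C r} ∧ ‖normalMap C r - e₁‖ < δ} with hA
  -- the open set
  set V : Set (Wsp e₁) := Metric.thickening (ω / 4 * t) (φ '' B) with hV
  have hVmem : ∀ p ∈ V, ∀ v : Wsp e₁, ‖v‖ ≤ ω / 4 * t → ∀ b, ε ≤ b → b ≤ 1 →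
      r₀ + ((p + v : Wsp e₁) : E3) - (b * t) • d ∈ C := by
    intro p hp v hv b hb hb1
    obtain ⟨_, ⟨r, hr, rfl⟩, hpr⟩ := Metric.mem_thickening_iff.1 hp
    rw [dist_eq_norm] at hpr
    have h := H t ht htt r hr (p - φ r + v) (by
      refine (norm_add_le _ _).trans ?_
      linarith) b hb hb1
    have e1 : t • w₀ + θ • Qmap e₁ d hd (r - r₀) + (p - φ r + v) = p + v := by
      change φ r + (p - φ r + v) = p + v
      abel
    rwa [e1] at h
  let g : Wsp e₁ → ℝ := fun q => sInf {s : ℝ | r₀ + (q : E3) - s • d ∈ C}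
  have hg : ∀ p ∈ V, 0 ≤ g p ∧ g p ≤ ε * t ∧ r₀ + (p : E3) - g p • d ∈ frontier C := by
    intro p hp
    refine g_spec hC.1 (fun x hx => (cone_sub hcone hx).1) hd p (ε * t) ?_
    have := hVmem p hp 0 (by rw [norm_zero]; positivity) ε le_rfl hε1.le
    rwa [add_zero] at this
  have hclose : ∀ p ∈ V, ∀ n, IsOutwardNormalAt C (r₀ + (p : E3) - g p • d) n →
      ‖n - e₁‖ < δ := by
    intro p hp n hn
    obtain ⟨h0, h1, -⟩ := hg p hp
    refine normal_close he₁ hd (σ := ω / 4 * t) (by positivity) hε1 ht h0 h1 hδ p hn ?_ ?_ ?_ ?_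
    · intro v hv
      exact hVmem p hp v hv ε le_rfl hε1.le
    · have := hVmem p hp 0 (by rw [norm_zero]; positivity) 1 hε1.le le_rfl
      rwa [add_zero, one_mul] at this
    · nlinarith
    · nlinarith
  have hae := ae_regular he₁ hC hd V Metric.isOpen_thickening g (fun p hp => (hg p hp).2.2)
    (fun p hp n hn => hδd n (hclose p hp n hn))
  have hsubs : φ '' B ⊆ ((fun r => Qmap e₁ d hd (r - r₀)) '' A) ∪
      {p | ¬ (p ∈ V → IsRegularPt C (r₀ + (p : E3) - g p • d))} := by
    intro p hp
    have hpV : p ∈ V := Metric.self_subset_thickening (by positivity) _ hp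
    by_cases hreg : IsRegularPt C (r₀ + (p : E3) - g p • d)
    · left
      obtain ⟨h0, h1, h2⟩ := hg p hpV
      refine ⟨r₀ + (p : E3) - g p • d, ⟨⟨⟨h2, ?_⟩, hreg⟩, hclose p hpV _ (normalMap_spec hreg)⟩, ?_⟩
      · obtain ⟨r, ⟨hrC, hrt⟩, rfl⟩ := hp
        have hrt : ⟪r - r₀, e⟫ = -t := hrt
        obtain ⟨hr1, hr2⟩ := cone_sub hcone hrC
        change ⟪r₀ + (φ r : E3) - g (φ r) • d - r₀, e⟫ ≥ -t
        have e1 : r₀ + (φ r : E3) - g (φ r) • d - r₀ = (φ r : E3) - g (φ r) • d := by abel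
        have e2 : ⟪(φ r : E3), e₂⟫ = -(t * ω) + θ * (⟪r - r₀, e₂⟫ - ⟪r - r₀, e₁⟫) := by
          change ⟪((t • w₀ + θ • Qmap e₁ d hd (r - r₀) : Wsp e₁) : E3), e₂⟫ = _
          simp only [Submodule.coe_add, Submodule.coe_smul, Qmap_coe]
          rw [inner_add_left, inner_smul_left, inner_smul_left, inner_sub_left, inner_smul_left,
            hw₀, hd₂]
          simp only [conj_trivial]
          ring
        rw [e1, inner_sub_left, inner_smul_left, hde, he, inner_add_right, inner_smul_right,
          inner_smul_right, wsp_inner, e2]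
        simp only [conj_trivial]
        rw [he, inner_add_right, inner_smul_right, inner_smul_right] at hrt
        have h := level_arith hl₁ hl₂ ht hθ0.le hθ4 hωl hr1 hr2 hrt hΛ0.le h1 hεΛ.le
        linarith
      · change Qmap e₁ d hd (r₀ + (p : E3) - g p • d - r₀) = p
        have e1 : r₀ + (p : E3) - g p • d - r₀ = (p : E3) - g p • d := by abel
        rw [e1, Qmap_eq]
    · right
      exact fun h => hreg (h hpV)
  calc μH[2] (φ '' B) ≤ μH[2] ((fun r => Qmap e₁ d hd (r - r₀)) '' A) +
        μH[2] {p | ¬ (p ∈ V → IsRegularPt C (r₀ + (p : E3) - g p • d))} :=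
        (measure_mono hsubs).trans (measure_union_le _ _)
    _ = μH[2] ((fun r => Qmap e₁ d hd (r - r₀)) '' A) := by
        rw [ae_iff.1 hae, add_zero]
    _ ≤ _ := hlip.hausdorffMeasure_image_le (by norm_num) A

lemma exists_d_w {e₁ e₂ : E3} (he₁ : ‖e₁‖ = 1) (he₂ : ‖e₂‖ = 1) (hne : e₁ ≠ e₂)
    (hne' : e₁ ≠ -e₂) (ω : ℝ) : ∃ d : E3, ⟪d, e₁⟫ = 1 ∧ ⟪d, e₂⟫ = 1 ∧
      ∃ w₀ : Wsp e₁, ⟪(w₀ : E3), e₂⟫ = -ω := by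
  have h11 : ⟪e₁, e₁⟫ = 1 := by rw [real_inner_self_eq_norm_sq, he₁]; norm_num
  have h22 : ⟪e₂, e₂⟫ = 1 := by rw [real_inner_self_eq_norm_sq, he₂]; norm_num
  set c := ⟪e₁, e₂⟫ with hc
  have h21 : ⟪e₂, e₁⟫ = c := real_inner_comm _ _
  have hp : 0 < 1 + c := by
    have h : 0 < ‖e₁ + e₂‖ ^ 2 := by
      have : e₁ + e₂ ≠ 0 := fun h => hne' (eq_neg_of_add_eq_zero_left h)
      positivity
    rw [norm_add_sq_real, he₁, he₂] at h
    linarith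
  have hm : 0 < 1 - c := by
    have h : 0 < ‖e₁ - e₂‖ ^ 2 := by
      have : e₁ - e₂ ≠ 0 := sub_ne_zero.2 hne
      positivity
    rw [norm_sub_sq_real, he₁, he₂] at h
    linarith
  refine ⟨(1 + c)⁻¹ • (e₁ + e₂), ?_, ?_, ⟨(-(ω / ((1 + c) * (1 - c)))) • (e₂ - c • e₁), ?_⟩, ?_⟩
  · rw [inner_smul_left, inner_add_left, h11, h21]
    simp only [conj_trivial]
    field_simp
  · rw [inner_smul_left, inner_add_left, h22, ← hc]
    simp only [conj_trivial]
    rw [add_comm c 1]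
    field_simp
  · rw [Submodule.mem_orthogonal_singleton_iff_inner_left, inner_smul_left, inner_sub_left,
      inner_smul_left, h11, h21]
    simp
  · change ⟪(-(ω / ((1 + c) * (1 - c)))) • (e₂ - c • e₁), e₂⟫ = -ω
    rw [inner_smul_left, inner_sub_left, inner_smul_left, h22, ← hc]
    simp only [conj_trivial]
    field_simp
    ring

lemma endpoint_mem (C : Set E3) (r₀ e₁ e₂ e : E3) (lam₁ lam₂ : ℝ)
    (hC : IsConvexBody C) (hr₀ : r₀ ∈ frontier C)
    (he₁ : ‖e₁‖ = 1) (he₂ : ‖e₂‖ = 1) (hne : e₁ ≠ e₂) (hne' : e₁ ≠ -e₂)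
    (hcone : tanCone C r₀ = dihedral e₁ e₂)
    (hl₁ : 0 < lam₁) (hl₂ : 0 < lam₂) (he : e = lam₁ • e₁ + lam₂ • e₂) (hnorm : ‖e‖ = 1)
    (ν₀ : Measure E3) (hν : IsPartialWeakLimit (nuT C r₀ e) ν₀) : e₁ ∈ msupport ν₀ := by
  intro U hU heU
  by_contra hcon
  have hU0 : ν₀ U = 0 := by simpa using hcon
  obtain ⟨ts, hts, hts0, hlim⟩ := hν
  have hr₀C : r₀ ∈ C := hC.1.isClosed.frontier_subset hr₀
  obtain ⟨d, hd, hd₂, w₀, hw₀⟩ := exists_d_w he₁ he₂ hne hne' (1 / (2 * lam₂))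
  obtain ⟨ρ, hρ, hρU⟩ := Metric.isOpen_iff.1 hU e₁ heU
  set δ₂ : ℝ := min ρ (1 / (2 * (‖d‖ + 1))) with hδ₂
  have hδ₂0 : 0 < δ₂ := by positivity
  set δ : ℝ := δ₂ / 2 with hδ
  have hδ0 : 0 < δ := by positivity
  have hδd₂ : ∀ n : E3, ‖n - e₁‖ < δ₂ → 1 / 2 ≤ ⟪d, n⟫ := by
    intro n hn
    have h1 : ⟪d, n⟫ = 1 + ⟪d, n - e₁⟫ := by rw [inner_sub_right, hd]; ring
    have h2 := (abs_le.1 (abs_real_inner_le_norm d (n - e₁))).1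
    have h3 : ‖n - e₁‖ ≤ 1 / (2 * (‖d‖ + 1)) := hn.le.trans (min_le_right _ _)
    rw [le_div_iff₀ (by positivity)] at h3
    nlinarith [norm_nonneg (n - e₁), norm_nonneg d]
  have hδd : ∀ n : E3, ‖n - e₁‖ < δ → 1 / 2 ≤ ⟪d, n⟫ := fun n hn => hδd₂ n (by linarith)
  obtain ⟨K, hK, t₁, ht₁, HK⟩ := main_area hC hr₀C he₁ he₂ hnorm hcone hl₁ hl₂ he hd hd₂ w₀ hw₀
    hδ0 hδd
  obtain ⟨t₂, ht₂, HB⟩ := B_pos hC hr₀C he₁ he₂ hnorm hcone hl₁ hl₂ he hd hd₂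
  -- the test function
  let f : BoundedContinuousFunction E3 ℝ := BoundedContinuousFunction.ofNormedAddCommGroup
    (fun x => max 0 (min 1 (2 - dist x e₁ / δ))) (by fun_prop) 1 (fun x => by
      rw [Real.norm_eq_abs, abs_of_nonneg (le_max_left _ _)]
      exact max_le zero_le_one (min_le_left _ _))
  have hf : ∀ x, f x = max 0 (min 1 (2 - dist x e₁ / δ)) := fun x => rfl
  have hf0 : ∀ x, 0 ≤ f x := fun x => le_max_left _ _
  have hf1 : ∀ x, f x ≤ 1 := fun x => max_le zero_le_one (min_le_left _ _)
  have hfb : ∀ x ∈ Metric.ball e₁ δ, f x = 1 := by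
    intro x hx
    have : dist x e₁ / δ ≤ 1 := (div_le_one hδ0).2 (Metric.mem_ball.1 hx).le
    rw [hf, min_eq_left (by linarith), max_eq_right zero_le_one]
  have hfs : ∀ x, x ∉ Metric.ball e₁ δ₂ → f x = 0 := by
    intro x hx
    have h1 : δ₂ ≤ dist x e₁ := by simpa using hx
    have : 2 ≤ dist x e₁ / δ := by rw [le_div_iff₀ hδ0]; linarith
    rw [hf, max_eq_left]
    exact (min_le_right _ _).trans (by linarith)
  have hint0 : ∫ x, f x ∂ν₀ = 0 := by
    refine integral_eq_zero_of_ae ?_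
    rw [Filter.EventuallyEq, ae_iff]
    refine measure_mono_null ?_ hU0
    intro x hx
    by_contra hxU
    refine hx (hfs x fun h => hxU (hρU (Metric.ball_subset_ball (min_le_left _ _) h)))
  have hl := hlim f
  rw [hint0] at hl
  have hlow : ∀ t, 0 < t → t ≤ t₁ → t ≤ t₂ → (K⁻¹).toReal ≤ ∫ x, f x ∂(nuT C r₀ e t) := by
    intro t ht h1 h2
    obtain ⟨hBtop, hBK⟩ := HK t ht h1
    have hBpos := HB t ht h2
    have hmeas := aemeasurable_normalMap hC.1 r₀ e t
    have happ : ∀ r, MeasurableSet (Metric.ball e₁ r) → nuT C r₀ e t (Metric.ball e₁ r) =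
        (μH[2] (Bset C r₀ e t))⁻¹ * μH[2] {r' | r' ∈ Sset C r₀ e t ∩ {r | IsRegularPt C r} ∧
        ‖normalMap C r' - e₁‖ < r} := by
      intro r hr
      rw [nuT, Measure.smul_apply, Measure.map_apply_of_aemeasurable hmeas hr,
        Measure.restrict_apply' (measurableSet_SR hC.1 r₀ e t), smul_eq_mul]
      congr 2
      ext x
      simp only [mem_inter_iff, mem_preimage, Metric.mem_ball, dist_eq_norm, mem_setOf_eq]
      tauto
    have hfinite : nuT C r₀ e t (Metric.ball e₁ δ₂) < ⊤ := by
      rw [happ δ₂ measurableSet_ball]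
      refine ENNReal.mul_lt_top (ENNReal.inv_lt_top.2 hBpos) ?_
      refine lt_of_le_of_lt (measure_mono ?_) (finite_near he₁ hC.1 hd)
      rintro r ⟨⟨hrS, hreg⟩, hr⟩
      exact ⟨hC.1.isClosed.frontier_subset hrS.1, _, normalMap_spec hreg, hδd₂ _ hr⟩
    have hsub : Metric.ball e₁ δ ⊆ Metric.ball e₁ δ₂ := Metric.ball_subset_ball (by linarith)
    have hint2 : Integrable ((Metric.ball e₁ δ₂).indicator (fun _ => (1 : ℝ))) (nuT C r₀ e t) :=
      (integrable_indicator_iff measurableSet_ball).2 (integrableOn_const hfinite.ne)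
    have hintf : Integrable f (nuT C r₀ e t) := by
      refine hint2.mono f.continuous.aestronglyMeasurable (Eventually.of_forall fun x => ?_)
      by_cases hx : x ∈ Metric.ball e₁ δ₂
      · rw [indicator_of_mem hx, Real.norm_eq_abs, abs_of_nonneg (hf0 x), norm_one]
        exact hf1 x
      · rw [hfs x hx, norm_zero]
        exact norm_nonneg _
    have hint1 : Integrable ((Metric.ball e₁ δ).indicator (fun _ => (1 : ℝ))) (nuT C r₀ e t) :=
      (integrable_indicator_iff measurableSet_ball).2
        (integrableOn_const ((measure_mono hsub).trans_lt hfinite).ne)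
    have hmono : ∫ x, (Metric.ball e₁ δ).indicator (fun _ => (1 : ℝ)) x ∂(nuT C r₀ e t) ≤
        ∫ x, f x ∂(nuT C r₀ e t) := by
      refine integral_mono hint1 hintf fun x => ?_
      by_cases hx : x ∈ Metric.ball e₁ δ
      · rw [indicator_of_mem hx, hfb x hx]
      · rw [indicator_of_notMem hx]
        exact hf0 x
    refine le_trans ?_ hmono
    rw [integral_indicator measurableSet_ball, setIntegral_const, smul_eq_mul, mul_one]
    refine ENNReal.toReal_mono ((measure_mono hsub).trans_lt hfinite).ne ?_
    rw [happ δ measurableSet_ball]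
    set b := μH[2] (Bset C r₀ e t)
    set a := μH[2] {r' | r' ∈ Sset C r₀ e t ∩ {r | IsRegularPt C r} ∧ ‖normalMap C r' - e₁‖ < δ}
    have hK0 : K ≠ 0 := by
      intro h
      rw [h, zero_mul] at hBK
      exact absurd (hBpos.trans_le hBK) (lt_irrefl _)
    calc K⁻¹ = K⁻¹ * (b⁻¹ * b) := by rw [ENNReal.inv_mul_cancel hBpos.ne' hBtop.ne, mul_one]
      _ ≤ K⁻¹ * (b⁻¹ * (K * a)) := by gcongr
      _ = (K⁻¹ * K) * (b⁻¹ * a) := by ring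
      _ = b⁻¹ * a := by rw [ENNReal.inv_mul_cancel hK0 hK, one_mul]
  have hKpos : 0 < (K⁻¹).toReal := by
    refine ENNReal.toReal_pos (ENNReal.inv_ne_zero.2 hK) ?_
    intro h
    have hK0 : K = 0 := ENNReal.inv_eq_top.1 h
    have hBK := (HK (min t₁ t₂) (by positivity) (min_le_left _ _)).2
    rw [hK0, zero_mul] at hBK
    exact absurd ((HB (min t₁ t₂) (by positivity) (min_le_right _ _)).trans_le hBK) (lt_irrefl _)
  have hev : ∀ᶠ i in atTop, (K⁻¹).toReal ≤ ∫ x, f x ∂(nuT C r₀ e (ts i)) := by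
    filter_upwards [hts0.eventually (gt_mem_nhds ht₁), hts0.eventually (gt_mem_nhds ht₂)]
      with i h1 h2
    exact hlow _ (hts i) h1.le h2.le
  have := ge_of_tendsto hl hev
  linarith

/-- **Lemma 3 of the paper.** The support of every partial weak limit of `ν_t` as
`t → 0⁺` contains both `e₁` and `e₂`. -/
theorem partial_weak_limit_support_contains_endpoints
    (C : Set E3) (r₀ e₁ e₂ e : E3) (lam₁ lam₂ : ℝ)
    (hC : IsConvexBody C) (hr₀ : r₀ ∈ frontier C)
    (he₁ : ‖e₁‖ = 1) (he₂ : ‖e₂‖ = 1) (hne : e₁ ≠ e₂) (hne' : e₁ ≠ -e₂)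
    (hcone : tanCone C r₀ = dihedral e₁ e₂)
    (hl₁ : 0 < lam₁) (hl₂ : 0 < lam₂) (he : e = lam₁ • e₁ + lam₂ • e₂) (hnorm : ‖e‖ = 1) :
    ∀ ν₀ : Measure E3, IsPartialWeakLimit (nuT C r₀ e) ν₀ →
      e₁ ∈ msupport ν₀ ∧ e₂ ∈ msupport ν₀ := by
  intro ν₀ hν
  refine ⟨endpoint_mem C r₀ e₁ e₂ e lam₁ lam₂ hC hr₀ he₁ he₂ hne hne' hcone hl₁ hl₂ he hnorm ν₀ hν,
    endpoint_mem C r₀ e₂ e₁ e lam₂ lam₁ hC hr₀ he₂ he₁ hne.symm ?_ ?_ hl₂ hl₁ ?_ hnorm ν₀ hν⟩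
  · intro h
    exact hne' (by rw [h, neg_neg])
  · rw [hcone]
    ext v
    exact and_comm
  · rw [he, add_comm]
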